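/- Let k ≥ 2 be an even integer. Then the limits ν(k−1) := lim_{d→∞} (log₂ K(d,k−1))/d and ν(k) := lim_{d→∞} (log₂ K(d,k))/d both exist and are equal. -/

import Mathlib

/-- Cyclic distance between two indices on a cycle of length `N`. -/
def cycDist {N : ℕ} (i j : ZMod N) : ℕ := min (j - i).val (i - j).val

/-- A `(d,k)` circuit code of length `N`: a simple cycle `x₁,…,x_N` in the
`d`-dimensional hypercube graph `I(d)` (vertices are binary vectors of length
`d`, adjacency is Hamming distance `1`, and the graph distance in `I(d)` equals
the Hamming distance) such that for any two vertices of the cycle the graph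
distance is at least the minimum of their distance along the cycle and `k`. -/
def IsCircuitCode (d k N : ℕ) (x : ZMod N → (Fin d → Bool)) : Prop :=
  3 ≤ N ∧ Function.Injective x ∧
    (∀ i : ZMod N, hammingDist (x i) (x (i + 1)) = 1) ∧
    (∀ i j : ZMod N, min (cycDist i j) k ≤ hammingDist (x i) (x j))

/-- `K d k`: the maximum length of a `(d,k)` circuit code. -/
noncomputable def K (d k : ℕ) : ℕ :=
  sSup {N | ∃ x : ZMod N → (Fin d → Bool), IsCircuitCode d k N x}

section Hamming

variable {ι κ : Type*} [Fintype ι] [Fintype κ]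

theorem hammingDist_comp_le (x y : κ → Bool) {g : ι → κ} (hg : Function.Injective g) :
    hammingDist (x ∘ g) (y ∘ g) ≤ hammingDist x y := by
  classical
  unfold hammingDist
  refine Finset.card_le_card_of_injOn g ?_ hg.injOn
  intro a ha
  simpa using ha

theorem hammingDist_extend (x y : ι → Bool) {g : ι → κ} (hg : Function.Injective g) :
    hammingDist (Function.extend g x fun _ => false) (Function.extend g y fun _ => false) =
      hammingDist x y := by
  classical
  unfold hammingDist
  symm
  refine Finset.card_bij (fun a _ => g a) ?_ (fun a _ b _ h => hg h) ?_
  · intro a ha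
    simpa [hg.extend_apply] using ha
  · intro c hc
    by_cases h : ∃ a, g a = c
    · obtain ⟨a, rfl⟩ := h
      exact ⟨a, by simpa [hg.extend_apply] using hc, rfl⟩
    · simp [Function.extend_apply' _ _ _ h] at hc

end Hamming

/-- A cyclic Gray code, as a periodic sequence. -/
theorem exists_gray_code (n : ℕ) : ∃ x : ℕ → Fin (n + 1) → Bool,
    (∀ i, x (i + 2 ^ (n + 1)) = x i) ∧ (∀ i, hammingDist (x i) (x (i + 1)) = 1) ∧
      ∀ i j, x i = x j → i % 2 ^ (n + 1) = j % 2 ^ (n + 1) := by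
  induction n with
  | zero =>
    refine ⟨fun i _ => decide (i % 2 = 1), fun i => ?_, fun i => ?_, fun i j h => ?_⟩
    · ext; simp
    · have : (decide (i % 2 = 1)) ≠ decide ((i + 1) % 2 = 1) := by
        rcases Nat.mod_two_eq_zero_or_one i with h | h <;> simp [h, Nat.add_mod]
      simp [hammingDist, this]
    · have := congrFun h 0
      simp only [decide_eq_decide] at this
      norm_num
      omega
  | succ n ih =>
    obtain ⟨x, hp, hs, hi⟩ := ih
    have hdist : ∀ (a b : Bool) (u v : Fin (n + 1) → Bool),
        hammingDist (Fin.cons a u : Fin (n + 2) → Bool) (Fin.cons b v) =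
          (if a ≠ b then 1 else 0) + hammingDist u v := by
      intro a b u v
      simp only [hammingDist, Finset.card_filter]
      rw [Fin.sum_univ_succ]
      simp
    refine ⟨fun i => Fin.cons (decide ((i + 1) / 2 % 2 = 1)) (x (i / 2)),
      fun i => ?_, fun i => ?_, fun i j h => ?_⟩
    · have e : 2 ^ (n + 1 + 1) = 2 * (2 * 2 ^ n) := by ring
      have e1 : (i + 2 ^ (n + 1 + 1)) / 2 = i / 2 + 2 ^ (n + 1) := by
        rw [e, pow_succ']; omega
      have e2 : (i + 2 ^ (n + 1 + 1) + 1) / 2 % 2 = (i + 1) / 2 % 2 := by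
        rw [e]; omega
      simp only [e1, e2, hp]
    · simp only [hdist]
      rcases Nat.even_or_odd' i with ⟨a, rfl | rfl⟩
      · have e1 : (2 * a + 1) / 2 = a := by omega
        have e2 : (2 * a) / 2 = a := by omega
        have e3 : (2 * a + 1 + 1) / 2 = a + 1 := by omega
        simp only [e1, e2, e3, hammingDist_self]
        rcases Nat.mod_two_eq_zero_or_one a with h | h <;> simp [h, Nat.add_mod]
      · have e1 : (2 * a + 1) / 2 = a := by omega
        have e3 : (2 * a + 1 + 1) / 2 = a + 1 := by omega
        have e4 : (2 * a + 1 + 1 + 1) / 2 = a + 1 := by omega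
        simp [e1, e3, e4, hs]
    · obtain ⟨h1, h2⟩ := Fin.cons_inj.1 h
      have h3 := hi _ _ h2
      simp only [decide_eq_decide] at h1
      have e : 2 ^ (n + 1) = 2 * 2 ^ n := by ring
      have h4 : i / 2 % 2 = j / 2 % 2 := by
        rw [← Nat.mod_mod_of_dvd (i / 2) (Dvd.intro _ e.symm), h3,
          Nat.mod_mod_of_dvd _ (Dvd.intro _ e.symm)]
      have h5 : i % 2 = j % 2 := by omega
      rw [pow_succ' 2 (n + 1), Nat.mod_mul, Nat.mod_mul, h3, h5]

/-- A sparse integer vector whose first power moments vanish is zero. -/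
theorem eq_zero_of_moments_eq_zero {n r : ℕ} (z : Fin n → ℤ)
    (hz : (Finset.univ.filter fun i => z i ≠ 0).card ≤ r)
    (h : ∀ j < r, ∑ i, z i * ((i : ℕ) : ℤ) ^ j = 0) : z = 0 := by
  by_contra hne
  obtain ⟨a, ha⟩ := Function.ne_iff.1 hne
  set D := Finset.univ.filter fun i => z i ≠ 0 with hD
  have haD : a ∈ D := by simpa [hD] using ha
  let p : Polynomial ℤ := ∏ i ∈ D.erase a, (Polynomial.X - Polynomial.C ((i : ℕ) : ℤ))
  have hdeg : p.natDegree < r := by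
    have : p.natDegree = (D.erase a).card := Polynomial.natDegree_finsetProd_X_sub_C_eq_card _ _
    rw [this, Finset.card_erase_of_mem haD]
    have := Finset.card_pos.2 ⟨a, haD⟩
    omega
  have hsum : ∑ i, z i * p.eval ((i : ℕ) : ℤ) = 0 := by
    simp only [Polynomial.eval_eq_sum_range' hdeg, Finset.mul_sum]
    rw [Finset.sum_comm]
    refine Finset.sum_eq_zero fun j hj => ?_
    have := h j (Finset.mem_range.1 hj)
    calc _ = p.coeff j * ∑ i, z i * ((i : ℕ) : ℤ) ^ j := by
          rw [Finset.mul_sum]; exact Finset.sum_congr rfl fun i _ => by ring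
      _ = 0 := by rw [this, mul_zero]
  rw [Finset.sum_eq_single a] at hsum
  · rcases mul_eq_zero.1 hsum with h0 | h0
    · exact ha h0
    · simp only [p, Polynomial.eval_prod, Finset.prod_eq_zero_iff] at h0
      obtain ⟨i, hi, h0⟩ := h0
      simp only [Polynomial.eval_sub, Polynomial.eval_X, Polynomial.eval_C, sub_eq_zero,
        Nat.cast_inj] at h0
      exact (Finset.mem_erase.1 hi).1 (Fin.ext h0.symm)
  · intro i _ hia
    by_cases hi : z i = 0
    · rw [hi, zero_mul]
    · have : p.eval ((i : ℕ) : ℤ) = 0 := by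
        simp only [p, Polynomial.eval_prod]
        exact Finset.prod_eq_zero (Finset.mem_erase.2 ⟨hia, by simpa [hD] using hi⟩) (by simp)
      rw [this, mul_zero]
  · simp

/-- A systematic binary code of minimum distance `r` with few check bits. -/
theorem exists_check_bits (n r B : ℕ) (hB : n ^ (r + 1) < 2 ^ B) :
    ∃ f : (Fin n → Bool) → Fin (r * (B * r)) → Bool, ∀ x y, x ≠ y →
      r ≤ hammingDist (Sum.elim x (f x)) (Sum.elim y (f y)) := by
  let M : (Fin n → Bool) → ℕ → ℕ := fun x j => ∑ i, if x i then (i : ℕ) ^ j else 0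
  have hM : ∀ x, ∀ j < r, M x j < 2 ^ B := by
    intro x j hj
    refine lt_of_le_of_lt ?_ hB
    calc M x j ≤ ∑ _i : Fin n, n ^ r := by
          refine Finset.sum_le_sum fun i _ => ?_
          split_ifs
          · exact (Nat.pow_le_pow_left i.2.le j).trans
              (Nat.pow_le_pow_right (by have := i.2; omega) hj.le)
          · exact Nat.zero_le _
      _ = n ^ (r + 1) := by simp [pow_succ']
  let e : Fin r × Fin B × Fin r ≃ Fin (r * (B * r)) :=
    ((Equiv.refl _).prodCongr finProdFinEquiv).trans finProdFinEquiv
  let f : (Fin n → Bool) → Fin (r * (B * r)) → Bool := fun x c =>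
    (M x (e.symm c).1).testBit (e.symm c).2.1
  refine ⟨f, fun x y hxy => ?_⟩
  by_cases hfar : r ≤ hammingDist x y
  · exact hfar.trans (hammingDist_comp_le (Sum.elim x (f x)) (Sum.elim y (f y)) Sum.inl_injective)
  have hex : ∃ j : Fin r, M x j ≠ M y j := by
    by_contra! hall
    apply hxy
    let z : Fin n → ℤ := fun i => (if x i then 1 else 0) - (if y i then 1 else 0)
    have hz0 : ∀ i, z i = 0 ↔ x i = y i := by
      intro i
      cases hx : x i <;> cases hy : y i <;> simp [z, hx, hy]
    have hz : z = 0 := by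
      refine eq_zero_of_moments_eq_zero (r := r) z ?_ fun j hj => ?_
      · simp only [ne_eq, hz0]
        exact (not_le.1 hfar).le
      · have h1 : (M x j : ℤ) = M y j := by exact_mod_cast hall ⟨j, hj⟩
        simp only [M] at h1
        push_cast at h1
        rw [← sub_eq_zero, ← Finset.sum_sub_distrib] at h1
        rw [← h1]
        refine Finset.sum_congr rfl fun i _ => ?_
        simp only [z]
        split_ifs <;> simp
    ext i
    rw [(hz0 i).1 (congrFun hz i)]
  obtain ⟨j, hj⟩ := hex
  have hb : ∃ b : Fin B, (M x j).testBit b ≠ (M y j).testBit b := by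
    by_contra! hall
    refine hj (Nat.eq_of_testBit_eq fun b => ?_)
    by_cases hbB : b < B
    · exact hall ⟨b, hbB⟩
    · have hp : 2 ^ B ≤ 2 ^ b := Nat.pow_le_pow_right (by norm_num) (not_lt.1 hbB)
      rw [Nat.testBit_lt_two_pow ((hM x j j.2).trans_le hp),
        Nat.testBit_lt_two_pow ((hM y j j.2).trans_le hp)]
  obtain ⟨b, hb⟩ := hb
  have hinj : Function.Injective
      (fun c : Fin r => (Sum.inr (e (j, b, c)) : Fin n ⊕ Fin (r * (B * r)))) := by
    intro c c' h
    simpa using h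
  refine le_trans ?_ (hammingDist_comp_le (Sum.elim x (f x)) (Sum.elim y (f y)) hinj)
  simp [hammingDist, f, hb]

/-- The number of times `σ < t` with `σ ≡ s` modulo `U`, for `s < U`. -/
def visits (U t s : ℕ) : ℕ := (t + (U - 1 - s)) / U

theorem visits_add_mul {U : ℕ} (hU : 0 < U) (t s q : ℕ) :
    visits U (t + U * q) s = visits U t s + q := by
  unfold visits
  rw [show t + U * q + (U - 1 - s) = t + (U - 1 - s) + U * q by ring,
    Nat.add_mul_div_left _ _ hU]

theorem visits_succ {U : ℕ} (t s : ℕ) (hs : s < U) :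
    visits U (t + 1) s = visits U t s + if t % U = s then 1 else 0 := by
  have hU : 0 < U := by omega
  obtain ⟨a, r, hr, rfl⟩ : ∃ a r, r < U ∧ t = r + U * a :=
    ⟨t / U, t % U, Nat.mod_lt _ hU, (Nat.mod_add_div _ _).symm⟩
  have key : ∀ b, b < 2 * U → b / U = if U ≤ b then 1 else 0 := by
    intro b hb
    split_ifs with h
    · exact Nat.div_eq_of_lt_le (by omega) (by omega)
    · exact Nat.div_eq_of_lt (by omega)
  rw [add_right_comm, visits_add_mul hU, visits_add_mul hU, Nat.add_mul_mod_self_left,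
    Nat.mod_eq_of_lt hr]
  unfold visits
  rw [key _ (by omega), key _ (by omega)]
  split_ifs <;> omega

theorem visits_anti {U : ℕ} (t : ℕ) {s s' : ℕ} (h : s ≤ s') :
    visits U t s' ≤ visits U t s :=
  Nat.div_le_div_right (by omega)

theorem visits_le_succ {U : ℕ} (hU : 0 < U) (t s s' : ℕ) :
    visits U t s ≤ visits U t s' + 1 := by
  unfold visits
  rw [← Nat.add_div_right _ hU]
  exact Nat.div_le_div_right (by omega)

/-- The parities of the visit counts, as a binary word. -/
def visitParity (U t : ℕ) : Fin U → Bool := fun s => decide (visits U t s % 2 = 1)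

theorem visitParity_add {U : ℕ} (hU : 0 < U) (t q : ℕ) :
    visitParity U (t + 2 * U * q) = visitParity U t := by
  ext s
  simp only [visitParity]
  rw [show t + 2 * U * q = t + U * (2 * q) by ring, visits_add_mul hU]
  simp

theorem visits_add_of_le {U : ℕ} (t s δ : ℕ) (hs : s < U) (hδ : δ ≤ U)
    (h : ∃ a < δ, (t + a) % U = s) : visits U (t + δ) s = visits U t s + 1 := by
  obtain ⟨a, ha, hmod⟩ := h
  have hlow : visits U t s + 1 ≤ visits U (t + δ) s := by
    calc visits U t s + 1 ≤ visits U (t + a) s + 1 := by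
          gcongr; exact Nat.div_le_div_right (by omega)
      _ = visits U (t + a + 1) s := by rw [visits_succ _ _ hs, if_pos hmod]
      _ ≤ _ := Nat.div_le_div_right (by omega)
  have hup : visits U (t + δ) s ≤ visits U t s + 1 := by
    have := visits_add_mul (U := U) (by omega) t s 1
    rw [← this]
    exact Nat.div_le_div_right (by omega)
  omega

theorem le_hammingDist_visitParity {U : ℕ} (t δ : ℕ) (hδ : δ ≤ U) :
    δ ≤ hammingDist (visitParity U t) (visitParity U (t + δ)) := by
  rcases Nat.eq_zero_or_pos U with rfl | hU
  · omega
  let g : Fin δ → Fin U := fun a => ⟨(t + a) % U, Nat.mod_lt _ hU⟩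
  have hg : Function.Injective g := by
    intro a b h
    have h1 : (t + a) % U = (t + b) % U := by simpa [g] using h
    have h2 : (a : ℕ) ≡ b [MOD U] := Nat.ModEq.add_left_cancel' t h1
    exact Fin.ext (Nat.ModEq.eq_of_lt_of_lt h2 (by omega) (by omega))
  refine le_trans ?_ (hammingDist_comp_le _ _ hg)
  have hne : ∀ a : Fin δ, visitParity U t (g a) ≠ visitParity U (t + δ) (g a) := by
    intro a
    have := visits_add_of_le t (g a) δ (g a).2 hδ ⟨a, a.2, rfl⟩
    simp only [visitParity, this]
    rcases Nat.mod_two_eq_zero_or_one (visits U t (g a)) with h | h <;> simp [h, Nat.add_mod]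
  simp [hammingDist, hne]

/-- A circuit obtained by flipping, at time `t`, one coordinate of the slot `t % U`, where each
slot runs through a closed walk, has spread `k` as soon as shifts by even numbers of rounds are
far apart. -/
theorem min_le_hammingDist_of_slots {ι : Type*} [Fintype ι] {U N k : ℕ} (hkU : k ≤ U)
    (hU : 0 < U) (hN : Even N) (slot : ι → ℕ) (v : ι → ℕ → Bool)
    (hper : ∀ c i, v c (i + N) = v c i)
    (hpar : ∀ s < U, ∀ i j, (∀ c, slot c = s → v c i = v c j) → i % 2 = j % 2)
    (P : ℕ → ι → Bool) (hP : ∀ t c, P t c = v c (visits U t (slot c)))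
    (hstep : ∀ t, hammingDist (P t) (P (t + 1)) = 1)
    (hfar : ∀ t q, 0 < q → 2 * q < N → 2 * k ≤ hammingDist (P t) (P (t + 2 * U * q)))
    (t δ : ℕ) (hδ : δ < N * U) :
    min (min δ (N * U - δ)) k ≤ hammingDist (P t) (P (t + δ)) := by
  have hper' : ∀ t, P (t + N * U) = P t := by
    intro t; ext c
    rw [hP, hP, mul_comm, visits_add_mul hU, hper]
  have hlip : ∀ t ε, hammingDist (P t) (P (t + ε)) ≤ ε := by
    intro t ε
    induction ε with
    | zero => simp
    | succ ε ih =>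
      have := hammingDist_triangle (P t) (P (t + ε)) (P (t + (ε + 1)))
      have h1 := hstep (t + ε)
      rw [add_assoc] at h1
      omega
  have hS : ∀ t t', hammingDist (visitParity U t) (visitParity U t') ≤
      hammingDist (P t) (P t') := by
    intro t t'
    classical
    unfold hammingDist
    refine Finset.card_le_card_of_surjOn
      (fun c => if h : slot c < U then ⟨slot c, h⟩ else ⟨0, hU⟩) ?_
    intro s hs
    by_contra hcon
    have : ∀ c, slot c = s → v c (visits U t s) = v c (visits U t' s) := by
      intro c hc
      by_contra hne
      refine hcon ⟨c, ?_, ?_⟩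
      · simpa [hP, hc] using hne
      · simp [hc]
    have := hpar s s.2 _ _ this
    simp [visitParity, this] at hs
  obtain ⟨q, ρ, hρ, rfl⟩ : ∃ q ρ, ρ < 2 * U ∧ δ = 2 * U * q + ρ :=
    ⟨δ / (2 * U), δ % (2 * U), Nat.mod_lt _ (by omega), (Nat.div_add_mod _ _).symm⟩
  have hlow : ρ ≤ U → ρ ≤ hammingDist (P t) (P (t + (2 * U * q + ρ))) := by
    intro h
    refine le_trans ?_ (hS _ _)
    have := le_hammingDist_visitParity t ρ h
    rwa [show t + (2 * U * q + ρ) = t + ρ + 2 * U * q by ring, visitParity_add hU]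
  have hhigh : U ≤ ρ → 2 * U - ρ ≤ hammingDist (P t) (P (t + (2 * U * q + ρ))) := by
    intro h
    refine le_trans ?_ (hS _ _)
    have := le_hammingDist_visitParity (U := U) (t + ρ) (2 * U - ρ) (by omega)
    rw [show t + ρ + (2 * U - ρ) = t + 2 * U * 1 by omega, visitParity_add hU,
      hammingDist_comm] at this
    rwa [show t + (2 * U * q + ρ) = t + ρ + 2 * U * q by ring, visitParity_add hU]
  obtain ⟨M, rfl⟩ := hN
  have e1 : (M + M) * U = 2 * U * M := by ring
  by_cases h1 : ρ < k
  · rcases Nat.eq_zero_or_pos q with rfl | hq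
    · have := hlow (by omega)
      omega
    · have hqM : q < M := by
        by_contra hle
        have : 2 * U * M ≤ 2 * U * q := Nat.mul_le_mul_left _ (not_lt.1 hle)
        omega
      have h2 := hfar t q hq (by omega)
      have h3 := hlip (t + 2 * U * q) ρ
      have h4 := hammingDist_triangle (P t) (P (t + (2 * U * q + ρ))) (P (t + 2 * U * q))
      rw [hammingDist_comm (P (t + (2 * U * q + ρ))), ← add_assoc] at h4
      rw [← add_assoc]
      omega
  · by_cases h2 : ρ ≤ 2 * U - k
    · rcases le_total ρ U with h | h
      · have := hlow h; omega
      · have := hhigh h; omega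
    · have h5 := hhigh (by omega)
      have hqM : q < M := by
        by_contra hle
        have : 2 * U * M ≤ 2 * U * q := Nat.mul_le_mul_left _ (not_lt.1 hle)
        omega
      have e2 : 2 * U * (q + 1) = 2 * U * q + 2 * U := by ring
      rcases Nat.lt_or_ge (q + 1) M with h6 | h6
      · have h2 := hfar t (q + 1) (by omega) (by omega)
        have h3 := hlip (t + (2 * U * q + ρ)) (2 * U - ρ)
        rw [show t + (2 * U * q + ρ) + (2 * U - ρ) = t + 2 * U * (q + 1) by omega] at h3
        have h4 := hammingDist_triangle (P t) (P (t + (2 * U * q + ρ))) (P (t + 2 * U * (q + 1)))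
        omega
      · obtain rfl : M = q + 1 := by omega
        omega

theorem isCircuitCode_of_periodic {ι : Type*} [Fintype ι] {d k T : ℕ} (hk : 1 ≤ k)
    (hd : Fintype.card ι ≤ d) (hT : 3 ≤ T) (P : ℕ → ι → Bool) (hper : ∀ t, P (t + T) = P t)
    (hstep : ∀ t, hammingDist (P t) (P (t + 1)) = 1)
    (hspread : ∀ t δ, δ < T → min (min δ (T - δ)) k ≤ hammingDist (P t) (P (t + δ))) :
    ∃ x : ZMod T → Fin d → Bool, IsCircuitCode d k T x := by
  have : NeZero T := ⟨by omega⟩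
  obtain ⟨g⟩ : Nonempty (ι ↪ Fin d) :=
    Function.Embedding.nonempty_of_card_le (by simpa using hd)
  have hval : ∀ i j : ZMod T, i.val ≤ j.val →
      min (cycDist i j) k ≤ hammingDist (P i.val) (P j.val) := by
    intro i j hij
    have hj := j.val_lt
    have h := hspread i.val (j.val - i.val) (by omega)
    rw [Nat.add_sub_cancel' hij] at h
    have h1 : (j - i).val = j.val - i.val := ZMod.val_sub hij
    have h2 : (i - j).val ≤ T - (j.val - i.val) := by
      rw [← neg_sub, ZMod.neg_val]
      split_ifs <;> omega
    refine le_trans (min_le_min_right _ ?_) h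
    unfold cycDist
    rw [h1]
    exact min_le_min_left _ h2
  have hall : ∀ i j : ZMod T, min (cycDist i j) k ≤ hammingDist (P i.val) (P j.val) := by
    intro i j
    rcases le_total i.val j.val with h | h
    · exact hval i j h
    · rw [hammingDist_comm, show cycDist i j = cycDist j i from min_comm _ _]
      exact hval j i h
  refine ⟨fun i => Function.extend g (P i.val) fun _ => false, hT, ?_, ?_, ?_⟩
  · intro i j hij
    have h0 : hammingDist (P i.val) (P j.val) = 0 := by
      rw [← hammingDist_extend _ _ g.injective,
        show Function.extend g (P i.val) (fun _ => false) = _ from hij, hammingDist_self]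
    have h1 := hall i j
    have h2 : cycDist i j = 0 := by omega
    unfold cycDist at h2
    rcases Nat.min_eq_zero_iff.1 h2 with h | h
    · exact (sub_eq_zero.1 ((ZMod.val_eq_zero _).1 h)).symm
    · exact sub_eq_zero.1 ((ZMod.val_eq_zero _).1 h)
  · intro i
    simp only
    rw [hammingDist_extend _ _ g.injective]
    have h1 : P (i + 1).val = P (i.val + 1) := by
      have : Fact (1 < T) := ⟨by omega⟩
      rw [ZMod.val_add, ZMod.val_one]
      have hi := i.val_lt
      rcases Nat.lt_or_ge (i.val + 1) T with h | h
      · rw [Nat.mod_eq_of_lt h]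
      · have : i.val + 1 = 0 + T := by omega
        rw [this, hper, Nat.zero_add, Nat.mod_self]
    rw [h1, hstep]
  · intro i j
    simp only
    rw [hammingDist_extend _ _ g.injective]
    exact hall i j

theorem bddAbove_length (d k : ℕ) :
    ∀ N ∈ {N | ∃ x : ZMod N → Fin d → Bool, IsCircuitCode d k N x}, N ≤ 2 ^ d := by
  rintro N ⟨x, hN, hx, -⟩
  have : NeZero N := ⟨by omega⟩
  simpa [ZMod.card] using Fintype.card_le_of_injective x hx

theorem K_le_two_pow (d k : ℕ) : K d k ≤ 2 ^ d := by
  unfold K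
  rcases Set.eq_empty_or_nonempty {N | ∃ x : ZMod N → Fin d → Bool, IsCircuitCode d k N x}
    with h | h
  · rw [h]; simp
  · exact csSup_le h (bddAbove_length d k)

theorem le_K {d k N : ℕ} (h : ∃ x : ZMod N → Fin d → Bool, IsCircuitCode d k N x) :
    N ≤ K d k :=
  le_csSup ⟨2 ^ d, bddAbove_length d k⟩ h

/-- Two copies of the check bits of a systematic code, updated before and after the data word
respectively, turn a Gray code into a circuit code of spread `k`. -/
theorem two_pow_le_K {n m k d : ℕ} (hk : 1 ≤ k) (hm : k ≤ m)
    (f : (Fin (n + 1) → Bool) → Fin m → Bool)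
    (hf : ∀ x y, x ≠ y → 2 * k ≤ hammingDist (Sum.elim x (f x)) (Sum.elim y (f y)))
    (hd : n + 1 + 4 * m ≤ d) : 2 ^ (n + 1) ≤ K d k := by
  obtain ⟨x, hxper, hxstep, hxinj⟩ := exists_gray_code n
  set N := 2 ^ (n + 1) with hNdef
  have hNeven : Even N := ⟨2 ^ n, by rw [hNdef]; ring⟩
  have hN2 : 2 ∣ N := hNeven.two_dvd
  have hNpos : 0 < N := by positivity
  let U := 2 * m + 1
  let slot : (Bool × Fin m × Bool) ⊕ Fin (n + 1) → ℕ :=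
    Sum.elim (fun c => if c.1 then m + 1 + c.2.1 else c.2.1) fun _ => m
  let v : (Bool × Fin m × Bool) ⊕ Fin (n + 1) → ℕ → Bool :=
    Sum.elim (fun c i => xor (f (x i) c.2.1) (c.2.2 && decide (i % 2 = 1))) fun b i => x i b
  have hslots : ∀ s < U, s = m ∨ ∃ (a : Bool) (w : Fin m), ∀ c, slot c = s ↔
      ∃ b, c = Sum.inl (a, w, b) := by
    intro s hs
    rcases lt_trichotomy s m with h | h | h
    · refine Or.inr ⟨false, ⟨s, h⟩, ?_⟩
      rintro (⟨_ | _, w, b⟩ | b) <;> simp [slot, Fin.ext_iff] <;> omega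
    · exact Or.inl h
    · refine Or.inr ⟨true, ⟨s - (m + 1), by omega⟩, ?_⟩
      rintro (⟨_ | _, w, b⟩ | b) <;> simp [slot, Fin.ext_iff] <;> omega
  have hslotm : ∀ c, slot c = m ↔ ∃ b, c = Sum.inr b := by
    rintro (⟨_ | _, w, b⟩ | b) <;> simp [slot] <;> omega
  have hslotlt : ∀ c, slot c < U := by
    rintro (⟨_ | _, w, b⟩ | b) <;> simp [slot, U] <;> omega
  have hflip : ∀ s < U, ∀ i, ∃ c, ∀ c', (slot c' = s ∧ v c' i ≠ v c' (i + 1)) ↔ c' = c := by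
    intro s hs i
    rcases hslots s hs with rfl | ⟨a, w, h⟩
    · obtain ⟨b, hb⟩ := Finset.card_eq_one.1 (hxstep i)
      refine ⟨Sum.inr b, fun c' => ?_⟩
      rw [hslotm]
      have hb' : ∀ b', x i b' ≠ x (i + 1) b' ↔ b' = b := by
        intro b'
        simpa using Finset.ext_iff.1 hb b'
      constructor
      · rintro ⟨⟨b', rfl⟩, h⟩
        rw [(hb' b').1 h]
      · rintro rfl
        exact ⟨⟨b, rfl⟩, (hb' b).2 rfl⟩
    · have hdec : decide ((i + 1) % 2 = 1) = !decide (i % 2 = 1) := by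
        rcases Nat.mod_two_eq_zero_or_one i with h | h <;> simp [h, Nat.add_mod]
      refine ⟨Sum.inl (a, w, decide (f (x i) w = f (x (i + 1)) w)), fun c' => ?_⟩
      rw [h]
      constructor
      · rintro ⟨⟨b, rfl⟩, h⟩
        revert h
        simp only [v, Sum.elim_inl, hdec]
        cases b <;> cases f (x i) w <;> cases f (x (i + 1)) w <;>
          cases decide (i % 2 = 1) <;> simp
      · rintro rfl
        refine ⟨⟨_, rfl⟩, ?_⟩
        simp only [v, Sum.elim_inl, hdec]
        cases f (x i) w <;> cases f (x (i + 1)) w <;> cases decide (i % 2 = 1) <;> simp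
  let P : ℕ → (Bool × Fin m × Bool) ⊕ Fin (n + 1) → Bool := fun t c => v c (visits U t (slot c))
  have hU : 0 < U := by omega
  have hvper : ∀ c i, v c (i + N) = v c i := by
    have hpar : ∀ i, (i + N) % 2 = i % 2 := by intro i; omega
    rintro (c | b) i
    · simp [v, hxper, hpar]
    · simp [v, hxper]
  have hstep : ∀ t, hammingDist (P t) (P (t + 1)) = 1 := by
    intro t
    obtain ⟨c, hc⟩ := hflip (t % U) (Nat.mod_lt _ hU) (visits U t (t % U))
    refine Finset.card_eq_one.2 ⟨c, ?_⟩
    ext c'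
    rw [Finset.mem_singleton, ← hc]
    simp only [Finset.mem_filter, Finset.mem_univ, true_and, P, visits_succ _ _ (hslotlt c')]
    by_cases h : t % U = slot c'
    · simp [h]
    · simp [h, Ne.symm h]
  have hpar : ∀ s < U, ∀ i j, (∀ c, slot c = s → v c i = v c j) → i % 2 = j % 2 := by
    intro s hs i j hij
    rcases hslots s hs with rfl | ⟨a, w, h⟩
    · have : x i = x j := funext fun b => hij (Sum.inr b) rfl
      rw [← Nat.mod_mod_of_dvd i hN2, hxinj i j this, Nat.mod_mod_of_dvd j hN2]
    · have h1 := hij _ ((h _).2 ⟨false, rfl⟩)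
      have h2 := hij _ ((h _).2 ⟨true, rfl⟩)
      simp only [v, Sum.elim_inl, Bool.false_and, Bool.xor_false, Bool.true_and] at h1 h2
      rw [h1, Bool.xor_right_inj, decide_eq_decide] at h2
      omega
  have hfar : ∀ t q, 0 < q → 2 * q < N → 2 * k ≤ hammingDist (P t) (P (t + 2 * U * q)) := by
    intro t q hq hqN
    set j := visits U t m with hj
    have hne : x j ≠ x (j + 2 * q) := by
      intro h
      have h1 : j + 0 ≡ j + 2 * q [MOD N] := hxinj _ _ h
      have h2 := Nat.ModEq.add_left_cancel' j h1
      have := Nat.ModEq.eq_of_lt_of_lt h2 hNpos hqN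
      omega
    have hcopy : ∃ a : Bool, ∀ w : Fin m, visits U t (slot (Sum.inl (a, w, false))) = j := by
      rcases eq_or_ne (visits U t 0) j with h0 | h0
      · refine ⟨false, fun w => ?_⟩
        have h1 := visits_anti (U := U) t (Nat.zero_le (w : ℕ))
        have h2 := visits_anti (U := U) t w.2.le
        simp only [slot, Sum.elim_inl, Bool.false_eq_true, if_false]
        omega
      · refine ⟨true, fun w => ?_⟩
        have h1 := visits_anti (U := U) t (Nat.zero_le m)
        have h2 := visits_anti (U := U) t (show m ≤ m + 1 + (w : ℕ) by omega)
        have h3 := visits_le_succ hU t 0 (m + 1 + (w : ℕ))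
        simp only [slot, Sum.elim_inl, if_true]
        omega
    obtain ⟨a, ha⟩ := hcopy
    have hvis : ∀ s, visits U (t + 2 * U * q) s = visits U t s + 2 * q := by
      intro s
      rw [show t + 2 * U * q = t + U * (2 * q) by ring, visits_add_mul hU]
    let g : Fin (n + 1) ⊕ Fin m → (Bool × Fin m × Bool) ⊕ Fin (n + 1) :=
      Sum.elim Sum.inr fun w => Sum.inl (a, w, false)
    have hg : Function.Injective g := by
      rintro (b | w) (b' | w') h <;> simp [g] at h ⊢ <;> exact h
    have e1 : P t ∘ g = Sum.elim (x j) (f (x j)) := by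
      ext (b | w)
      · simp [P, g, v, slot, hj]
      · simp only [P, g, Function.comp_apply, Sum.elim_inr, ha]
        simp [v]
    have e2 : P (t + 2 * U * q) ∘ g = Sum.elim (x (j + 2 * q)) (f (x (j + 2 * q))) := by
      ext (b | w)
      · simp [P, g, v, slot, hj, hvis]
      · simp only [P, g, Function.comp_apply, Sum.elim_inr, hvis, ha]
        simp [v]
    calc 2 * k ≤ _ := hf _ _ hne
      _ = hammingDist (P t ∘ g) (P (t + 2 * U * q) ∘ g) := by rw [e1, e2]
      _ ≤ _ := hammingDist_comp_le _ _ hg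
  have hNle : N ≤ N * U := Nat.le_mul_of_pos_right _ hU
  have hN2le : 2 ≤ N := Nat.le_of_dvd hNpos hN2
  refine hNle.trans (le_K (isCircuitCode_of_periodic hk ?_ ?_ P ?_ hstep
    (min_le_hammingDist_of_slots (by omega) hU hNeven slot v hvper hpar P (fun _ _ => rfl)
      hstep hfar)))
  · simp only [Fintype.card_sum, Fintype.card_prod, Fintype.card_bool, Fintype.card_fin]
    omega
  · have : N * 3 ≤ N * U := Nat.mul_le_mul_left _ (by omega)
    omega
  · intro t
    ext c
    simp only [P]
    rw [mul_comm, visits_add_mul hU, hvper]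

/-- Circuit codes of any fixed spread have asymptotic rate one. -/
theorem tendsto_logb_K_div (k : ℕ) (hk : 1 ≤ k) :
    Filter.Tendsto (fun d : ℕ => Real.logb 2 (K d k) / d) Filter.atTop (nhds 1) := by
  obtain ⟨C, hC⟩ : ∃ C, C = 4 * (2 * k * ((2 * k + 1) * (2 * k))) := ⟨_, rfl⟩
  have hlow : ∀ d : ℕ, C * (Nat.log 2 d + 1) < d →
      2 ^ (d - C * (Nat.log 2 d + 1)) ≤ K d k := by
    intro d hd
    obtain ⟨n, hn⟩ : ∃ n, d - C * (Nat.log 2 d + 1) = n + 1 := ⟨_, (Nat.succ_pred (by omega)).symm⟩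
    rw [hn]
    let B := (Nat.log 2 d + 1) * (2 * k + 1)
    have hB : (n + 1) ^ (2 * k + 1) < 2 ^ B := by
      rw [pow_mul]
      refine Nat.pow_lt_pow_left (lt_of_le_of_lt ?_ (Nat.lt_pow_succ_log_self one_lt_two d))
        (by omega)
      omega
    obtain ⟨f, hf⟩ := exists_check_bits (n + 1) (2 * k) B hB
    have e : 4 * (2 * k * (B * (2 * k))) = C * (Nat.log 2 d + 1) := by
      simp only [B, hC]; ring
    refine two_pow_le_K (m := 2 * k * (B * (2 * k))) hk ?_ f hf (by omega)
    have hB1 : 1 ≤ B := Nat.one_le_iff_ne_zero.2 (by simp [B])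
    calc k ≤ 2 * k * (1 * 1) := by omega
      _ ≤ 2 * k * (B * (2 * k)) := by gcongr; omega
  have hlim0 : Filter.Tendsto (fun d : ℕ => (Nat.log 2 d : ℝ) / d) Filter.atTop (nhds 0) := by
    have h1 : Filter.Tendsto (fun d : ℕ => Real.log d / d / Real.log 2) Filter.atTop (nhds 0) := by
      have := (Real.isLittleO_log_id_atTop.tendsto_div_nhds_zero.comp
        tendsto_natCast_atTop_atTop).div_const (Real.log 2)
      simpa using this
    refine squeeze_zero (fun d => by positivity) (fun d => ?_) h1
    rw [div_right_comm]
    gcongr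
    exact Real.natLog_le_logb d 2
  have hlim : Filter.Tendsto (fun d : ℕ => 1 - C * ((Nat.log 2 d : ℝ) / d + 1 / d))
      Filter.atTop (nhds 1) := by
    have := (hlim0.add tendsto_one_div_atTop_nhds_zero_nat).const_mul (C : ℝ)
    simpa using this.const_sub 1
  have hev : ∀ᶠ d : ℕ in Filter.atTop, C * (Nat.log 2 d + 1) < d := by
    filter_upwards [hlim.eventually (lt_mem_nhds one_pos), Filter.eventually_gt_atTop 0]
      with d hd hd0
    have hd0' : (0 : ℝ) < d := by exact_mod_cast hd0
    have e : 1 - C * ((Nat.log 2 d : ℝ) / d + 1 / d) = (d - C * (Nat.log 2 d + 1)) / d := by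
      field_simp
    rw [e, div_pos_iff_of_pos_right hd0', sub_pos] at hd
    exact_mod_cast hd
  refine tendsto_of_tendsto_of_tendsto_of_le_of_le' hlim tendsto_const_nhds ?_ ?_
  · filter_upwards [hev] with d hd
    have hd0' : (0 : ℝ) < d := by exact_mod_cast (Nat.zero_le _).trans_lt hd
    have e : 1 - C * ((Nat.log 2 d : ℝ) / d + 1 / d) = (d - C * (Nat.log 2 d + 1)) / d := by
      field_simp
    rw [e]
    gcongr
    have h1 : ((2 : ℝ) ^ (d - C * (Nat.log 2 d + 1)) : ℝ) ≤ K d k := by exact_mod_cast hlow d hd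
    calc (d : ℝ) - C * (Nat.log 2 d + 1) = ((d - C * (Nat.log 2 d + 1) : ℕ) : ℝ) := by
          rw [Nat.cast_sub hd.le]; push_cast; ring
      _ = Real.logb 2 ((2 : ℝ) ^ (d - C * (Nat.log 2 d + 1))) := by
          rw [Real.logb_pow, Real.logb_self_eq_one one_lt_two, mul_one]
      _ ≤ _ := Real.logb_le_logb_of_le one_lt_two (by positivity) h1
  · filter_upwards [hev] with d hd
    have hd0' : (0 : ℝ) < d := by exact_mod_cast (Nat.zero_le _).trans_lt hd
    have h0 : (0 : ℝ) < K d k := by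
      exact_mod_cast lt_of_lt_of_le (by positivity) (hlow d hd)
    rw [div_le_one hd0']
    calc Real.logb 2 (K d k) ≤ Real.logb 2 ((2 : ℝ) ^ d) :=
          Real.logb_le_logb_of_le one_lt_two h0 (by exact_mod_cast K_le_two_pow d k)
      _ = d := by rw [Real.logb_pow, Real.logb_self_eq_one one_lt_two, mul_one]

/-- For even `k ≥ 2`, the limits `ν(k−1)` and `ν(k)` both exist and are
equal. -/
theorem stmt_8 (k : ℕ) (hk : 2 ≤ k) (hke : Even k) :
    ∃ L : ℝ,
      Filter.Tendsto (fun d : ℕ => Real.logb 2 (K d (k - 1)) / d)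
        Filter.atTop (nhds L) ∧
      Filter.Tendsto (fun d : ℕ => Real.logb 2 (K d k) / d)
        Filter.atTop (nhds L) := by
  exact ⟨1, tendsto_logb_K_div (k - 1) (by omega), tendsto_logb_K_div k (by omega)⟩
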